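/- (Convergence of the exponential integrator scheme, scalar semilinear case.) Let 0 < α < 1, λ ≥ 0, τ > 0, N ∈ ℕ, T = Nτ, t_k = kτ. Let F : ℝ → ℝ be Lipschitz with constant L_F, and let u : [0,T] → ℝ be continuous, satisfy the integral equation u(t) = E_α(−λ t^α) u(0) + ∫₀ᵗ (t−r)^{α−1} E_{α,α}(−λ(t−r)^α) F(u(r)) dr for all t ∈ [0,T], and satisfy |u(r) − u(r′)| ≤ L₀ |r−r′|^α for r, r′ ∈ [0,t_1] and |u(r) − u(r′)| ≤ L₀ |r−r′| for r, r′ ∈ [t_1, T]. Define the exponential integrator approximations by U⁰ = u(0) and Uⁿ = E_α(−λ t_n^α) U⁰ + Σ_{j=0}^{n−1} W_{n,j} F(U^j) for 1 ≤ n ≤ N, where W_{n,j} = (t_n−t_j)^α E_{α,α+1}(−λ(t_n−t_j)^α) − (t_n−t_{j+1})^α E_{α,α+1}(−λ(t_n−t_{j+1})^α). Then there exists a constant C, depending only on α, λ, L_F, L₀ and T, such that for every 1 ≤ n ≤ N, |u(t_n) − Uⁿ| ≤ C ( τ + t_n^{α−1} τ^{1+α} ). -/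

import Mathlib

open MeasureTheory Set

/-- The (real) Mittag-Leffler function `E_{α,β}(x) = Σ_{k} x^k / Γ(αk+β)`. -/
noncomputable def mlE (α β x : ℝ) : ℝ :=
  ∑' k : ℕ, x ^ k / Real.Gamma (α * k + β)

/-- The exponential integrator weight
`W_{n,j} = (t_n−t_j)^α E_{α,α+1}(−λ(t_n−t_j)^α)
          − (t_n−t_{j+1})^α E_{α,α+1}(−λ(t_n−t_{j+1})^α)` with `t_k = kτ`. -/
noncomputable def eiWeight (α lam τ : ℝ) (n j : ℕ) : ℝ :=
  ((n : ℝ) * τ - j * τ) ^ α * mlE α (α + 1) (-lam * ((n : ℝ) * τ - j * τ) ^ α)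
    - ((n : ℝ) * τ - (j + 1) * τ) ^ α
        * mlE α (α + 1) (-lam * ((n : ℝ) * τ - (j + 1) * τ) ^ α)

theorem le_Gamma_of_pos {s R : ℝ} (hs : 0 < s) (hR : 0 < R) :
    Real.exp (-(R + 1)) * (R ^ s / (R + 1)) ≤ Real.Gamma s := by
  rw [Real.Gamma_eq_integral hs]
  have hsub : Ioc R (R + 1) ⊆ Ioi 0 := fun x hx => hR.trans hx.1
  have hint := Real.GammaIntegral_convergent hs
  calc Real.exp (-(R + 1)) * (R ^ s / (R + 1))
      = ∫ _ in Ioc R (R + 1), Real.exp (-(R + 1)) * (R ^ s / (R + 1)) := by simp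
    _ ≤ ∫ x in Ioc R (R + 1), Real.exp (-x) * x ^ (s - 1) := by
        refine setIntegral_mono_on (integrableOn_const (by simp)) (hint.mono_set hsub) measurableSet_Ioc
          fun x hx => ?_
        have hx0 : 0 < x := hsub hx
        have h1 : R ≤ x := hx.1.le
        have h2 : x ≤ R + 1 := hx.2
        rw [Real.rpow_sub_one hx0.ne']
        gcongr
    _ ≤ ∫ x in Ioi 0, Real.exp (-x) * x ^ (s - 1) := by
        refine setIntegral_mono_set hint ?_ hsub.eventuallyLE
        filter_upwards [ae_restrict_mem measurableSet_Ioi] with x hx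
        have hx0 : (0 : ℝ) < x := hx
        simp only [Pi.zero_apply]
        positivity

theorem summable_mlE {α β : ℝ} (hα : 0 < α) (hβ : 0 < β) {x : ℝ} (hx : 0 ≤ x) :
    Summable fun k : ℕ => x ^ k / Real.Gamma (α * k + β) := by
  set R : ℝ := (2 * x + 1) ^ α⁻¹ with hRdef
  have hR : 0 < R := by positivity
  have hRα : R ^ α = 2 * x + 1 := by
    rw [hRdef, ← Real.rpow_mul (by positivity), inv_mul_cancel₀ hα.ne', Real.rpow_one]
  set c : ℝ := Real.exp (-(R + 1)) * (R ^ β / (R + 1)) with hc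
  have hcpos : 0 < c := by positivity
  have hgeo : Summable fun k : ℕ => c⁻¹ * (1 / 2 : ℝ) ^ k :=
    (summable_geometric_of_lt_one (by norm_num) (by norm_num)).mul_left _
  refine Summable.of_nonneg_of_le (fun k => ?_) (fun k => ?_) hgeo
  · have := Real.Gamma_pos_of_pos (show 0 < α * k + β by positivity)
    positivity
  · have hs : 0 < α * k + β := by positivity
    have hG := le_Gamma_of_pos hs hR
    rw [Real.rpow_add hR, Real.rpow_mul hR.le, hRα, Real.rpow_natCast] at hG
    have hG' : c * (2 * x + 1) ^ k ≤ Real.Gamma (α * k + β) := by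
      refine le_trans (le_of_eq ?_) hG
      rw [hc]; ring
    calc x ^ k / Real.Gamma (α * k + β) ≤ x ^ k / (c * (2 * x + 1) ^ k) := by gcongr
      _ = c⁻¹ * (x / (2 * x + 1)) ^ k := by
        rw [div_pow]; field_simp
      _ ≤ c⁻¹ * (1 / 2 : ℝ) ^ k := by
        refine mul_le_mul_of_nonneg_left (pow_le_pow_left₀ (by positivity) ?_ k) (by positivity)
        rw [div_le_div_iff₀ (by positivity) (by norm_num)]
        linarith

theorem norm_mlE_term_le {α β : ℝ} (hα : 0 < α) (hβ : 0 < β) {x R : ℝ} (hx : |x| ≤ R)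
    (k : ℕ) :
    ‖x ^ k / Real.Gamma (α * k + β)‖ ≤ R ^ k / Real.Gamma (α * k + β) := by
  have := Real.Gamma_pos_of_pos (show 0 < α * k + β by positivity)
  rw [norm_div, norm_pow, Real.norm_eq_abs, Real.norm_of_nonneg this.le]
  gcongr

theorem abs_mlE_le {α β : ℝ} (hα : 0 < α) (hβ : 0 < β) {x R : ℝ} (hx : |x| ≤ R) :
    |mlE α β x| ≤ mlE α β R :=
  tsum_of_norm_bounded (summable_mlE hα hβ ((abs_nonneg x).trans hx)).hasSum
    (norm_mlE_term_le hα hβ hx)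

theorem mlE_nonneg {α β : ℝ} (hα : 0 < α) (hβ : 0 < β) {x : ℝ} (hx : 0 ≤ x) :
    0 ≤ mlE α β x :=
  (abs_nonneg _).trans (abs_mlE_le hα hβ (abs_of_nonneg hx).le)

theorem continuous_mlE {α β : ℝ} (hα : 0 < α) (hβ : 0 < β) : Continuous (mlE α β) := by
  rw [continuous_iff_continuousAt]
  intro x
  have hcont : ContinuousOn (mlE α β) (Icc (-(|x| + 1)) (|x| + 1)) :=
    continuousOn_tsum (fun k => by fun_prop)
      (summable_mlE hα hβ (show 0 ≤ |x| + 1 by positivity))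
      fun k y hy => norm_mlE_term_le hα hβ (abs_le.2 hy) k
  refine hcont.continuousAt (Icc_mem_nhds ?_ ?_)
  · linarith [neg_abs_le x]
  · linarith [le_abs_self x]

/-- The kernel `s^{α-1} E_{α,α}(-λ s^α)` of the variation-of-constants formula. -/
noncomputable def mlKernel (α lam s : ℝ) : ℝ :=
  s ^ (α - 1) * mlE α α (-lam * s ^ α)

theorem abs_mlKernel_le {α lam T s : ℝ} (hα : 0 < α) (hlam : 0 ≤ lam) (hs : 0 ≤ s)
    (hsT : s ≤ T) : |mlKernel α lam s| ≤ mlE α α (lam * T ^ α) * s ^ (α - 1) := by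
  have h : |(-lam * s ^ α)| ≤ lam * T ^ α := by
    rw [abs_mul, abs_neg, abs_of_nonneg hlam, abs_of_nonneg (by positivity)]
    gcongr
  rw [mlKernel, abs_mul, abs_of_nonneg (by positivity), mul_comm]
  gcongr
  exact abs_mlE_le hα hα h

theorem intervalIntegrable_mlKernel {α : ℝ} (hα : 0 < α) (lam a b : ℝ) :
    IntervalIntegrable (mlKernel α lam) volume a b := by
  unfold mlKernel
  refine (intervalIntegral.intervalIntegrable_rpow' (r := α - 1) (by linarith)).mul_continuousOn ?_
  have := continuous_mlE hα hα
  have h2 : Continuous fun s : ℝ => s ^ α := Real.continuous_rpow_const hα.le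
  fun_prop

theorem integral_mlKernel {α : ℝ} (hα : 0 < α) (lam : ℝ) {t : ℝ} (ht : 0 ≤ t) :
    ∫ s in (0 : ℝ)..t, mlKernel α lam s = t ^ α * mlE α (α + 1) (-lam * t ^ α) := by
  have hterm : ∀ c : ℝ, ∀ k : ℕ, ∫ s in (0 : ℝ)..t,
      s ^ (α - 1) * ((c * s ^ α) ^ k / Real.Gamma (α * k + α))
      = t ^ α * ((c * t ^ α) ^ k / Real.Gamma (α * k + (α + 1))) := by
    intro c k
    have hk : 0 < α * k + α := by positivity
    have hpow : ∀ s : ℝ, 0 < s → ∀ d : ℝ, s ^ d * (c * s ^ α) ^ k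
        = c ^ k * s ^ (α * k + d) := by
      intro s hs d
      rw [mul_pow, ← Real.rpow_natCast (s ^ α), ← Real.rpow_mul hs.le, Real.rpow_add hs]
      ring
    have h1 : ∫ s in (0 : ℝ)..t, s ^ (α - 1) * ((c * s ^ α) ^ k / Real.Gamma (α * k + α))
        = ∫ s in (0 : ℝ)..t, c ^ k / Real.Gamma (α * k + α) * s ^ (α * k + (α - 1)) := by
      refine intervalIntegral.integral_congr_ae (Filter.Eventually.of_forall fun s hs => ?_)
      rw [uIoc_of_le ht] at hs
      rw [← mul_div_assoc, hpow s hs.1]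
      ring
    rw [h1, intervalIntegral.integral_const_mul, integral_rpow (Or.inl (by linarith)),
      show α * k + (α - 1) + 1 = α * k + α by ring, Real.zero_rpow hk.ne', sub_zero,
      show α * k + (α + 1) = α * k + α + 1 by ring, Real.Gamma_add_one hk.ne']
    have hG := (Real.Gamma_pos_of_pos hk).ne'
    rcases ht.eq_or_lt with rfl | ht'
    · simp [Real.zero_rpow hα.ne', Real.zero_rpow hk.ne']
    · rw [← mul_div_assoc (t ^ α), hpow t ht' α]
      field_simp
  have hint : ∀ c : ℝ, ∀ k : ℕ, IntegrableOn
      (fun s : ℝ => s ^ (α - 1) * ((c * s ^ α) ^ k / Real.Gamma (α * k + α))) (Ioc 0 t) := by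
    intro c k
    rw [← intervalIntegrable_iff_integrableOn_Ioc_of_le ht]
    refine (intervalIntegral.intervalIntegrable_rpow' (r := α - 1) (by linarith)).mul_continuousOn ?_
    have h2 : Continuous fun s : ℝ => s ^ α := Real.continuous_rpow_const hα.le
    fun_prop
  have key := hasSum_integral_of_summable_integral_norm (μ := volume.restrict (Ioc 0 t))
    (hint (-lam)) (by
      have hsum : Summable fun k : ℕ =>
          t ^ α * ((|lam| * t ^ α) ^ k / Real.Gamma (α * k + (α + 1))) :=
        (summable_mlE hα (by linarith) (by positivity)).mul_left _
      refine hsum.congr fun k => ?_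
      rw [← hterm, intervalIntegral.integral_of_le ht]
      refine setIntegral_congr_fun measurableSet_Ioc fun s hs => ?_
      have hs0 : 0 < s := hs.1
      have hG := Real.Gamma_pos_of_pos (show 0 < α * k + α by positivity)
      simp only [norm_mul, norm_div, norm_pow, norm_neg, Real.norm_eq_abs]
      rw [abs_of_pos hG, abs_of_pos (Real.rpow_pos_of_pos hs0 _),
        abs_of_pos (Real.rpow_pos_of_pos hs0 _)])
  rw [intervalIntegral.integral_of_le ht]
  simp only [mlKernel, mlE, ← tsum_mul_left]
  rw [← key.tsum_eq]
  refine tsum_congr fun k => ?_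
  rw [← hterm, intervalIntegral.integral_of_le ht]

theorem rpow_sub_rpow_le {p a b : ℝ} (hp : 0 ≤ p) (hp1 : p ≤ 1) (ha : 0 < a) (hb : 0 ≤ b)
    (hab : b ≤ a) : a ^ p - b ^ p ≤ (a - b) * a ^ (p - 1) := by
  have hle : b / a ≤ 1 := (div_le_one ha).2 hab
  have h0 : 0 ≤ b / a := by positivity
  have h : b / a ≤ (b / a) ^ p := by
    simpa using Real.rpow_le_rpow_of_exponent_ge' h0 hle hp hp1
  rw [Real.div_rpow hb ha.le, div_le_div_iff₀ ha (by positivity)] at h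
  rw [Real.rpow_sub_one ha.ne', ← mul_div_assoc, le_div_iff₀ ha]
  nlinarith

theorem mul_rpow_sub_one_le {p a b : ℝ} (hp : 0 ≤ p) (hp1 : p ≤ 1) (ha : 0 < a) (hb : 0 ≤ b) :
    p * ((a - b) * a ^ (p - 1)) ≤ a ^ p - b ^ p := by
  have h0 : 0 ≤ b / a := by positivity
  have h := rpow_one_add_le_one_add_mul_self (s := b / a - 1) (by linarith) hp hp1
  rw [add_sub_cancel, Real.div_rpow hb ha.le, div_le_iff₀ (by positivity)] at h
  rw [Real.rpow_sub_one ha.ne']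
  have h2 : (1 + p * (b / a - 1)) * a ^ p = a ^ p - p * ((a - b) * (a ^ p / a)) := by
    field_simp
    ring
  linarith

theorem sum_Ico_mul_rpow_le {p τ : ℝ} (hp : 0 < p) (hp1 : p ≤ 1) (hτ : 0 < τ) (n : ℕ) :
    ∑ j ∈ Finset.Ico 1 n, τ * (j * τ) ^ (p - 1) ≤ (n * τ) ^ p / p := by
  have hmain : ∀ m : ℕ, ∑ j ∈ Finset.range m, τ * ((j + 1 : ℕ) * τ) ^ (p - 1)
      ≤ (m * τ) ^ p / p := by
    intro m
    rw [le_div_iff₀ hp, Finset.sum_mul]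
    have htel := Finset.sum_range_sub (fun i : ℕ => ((i : ℝ) * τ) ^ p) m
    simp only [Nat.cast_zero, zero_mul, Real.zero_rpow hp.ne', sub_zero] at htel
    rw [← htel]
    refine Finset.sum_le_sum fun j _ => ?_
    have h := mul_rpow_sub_one_le hp.le hp1 (a := (j + 1 : ℕ) * τ) (b := j * τ)
      (by positivity) (by positivity)
    refine le_trans (le_of_eq ?_) h
    push_cast
    ring
  rw [Finset.sum_Ico_eq_sum_range]
  refine le_trans (le_of_eq ?_) ((hmain (n - 1)).trans ?_)
  · exact Finset.sum_congr rfl fun j _ => by rw [add_comm 1 j]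
  · gcongr
    omega

theorem sum_Ico_sub_mul_rpow_le {p τ : ℝ} (hp : 0 < p) (hp1 : p ≤ 1) (hτ : 0 < τ) (n : ℕ) :
    ∑ j ∈ Finset.Ico 1 n, τ * (n * τ - j * τ) ^ (p - 1) ≤ (n * τ) ^ p / p := by
  refine le_trans (le_of_eq ?_) (sum_Ico_mul_rpow_le hp hp1 hτ n)
  have h := Finset.sum_Ico_reflect (fun j : ℕ => τ * (j * τ) ^ (p - 1)) 1 (m := n) (n := n)
    (by omega)
  rw [Nat.add_sub_cancel_left, Nat.add_sub_cancel] at h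
  rw [← h]
  refine Finset.sum_congr rfl fun j hj => ?_
  rw [Nat.cast_sub (Finset.mem_Ico.1 hj).2.le, sub_mul]

theorem rpow_mul_rpow_le_of_add {p q a b : ℝ} (hp1 : p ≤ 1) (hq1 : q ≤ 1)
    (ha : 0 < a) (hb : 0 < b) :
    a ^ (q - 1) * b ^ (p - 1) ≤
      ((a + b) / 2) ^ (q - 1) * b ^ (p - 1) + ((a + b) / 2) ^ (p - 1) * a ^ (q - 1) := by
  rcases le_total a b with h | h
  · have h1 : b ^ (p - 1) ≤ ((a + b) / 2) ^ (p - 1) :=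
      Real.rpow_le_rpow_of_nonpos (by positivity) (by linarith) (by linarith)
    have h2 : 0 ≤ ((a + b) / 2) ^ (q - 1) * b ^ (p - 1) := by positivity
    have h3 : 0 < a ^ (q - 1) := by positivity
    nlinarith
  · have h1 : a ^ (q - 1) ≤ ((a + b) / 2) ^ (q - 1) :=
      Real.rpow_le_rpow_of_nonpos (by positivity) (by linarith) (by linarith)
    have h2 : 0 ≤ ((a + b) / 2) ^ (p - 1) * a ^ (q - 1) := by positivity
    have h3 : 0 < b ^ (p - 1) := by positivity
    nlinarith

/-- A discrete Beta-function estimate. -/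
theorem sum_Ico_beta_le {p q τ : ℝ} (hp : 0 < p) (hp1 : p ≤ 1) (hq : 0 < q) (hq1 : q ≤ 1)
    (hτ : 0 < τ) {n : ℕ} (hn : 1 ≤ n) :
    ∑ j ∈ Finset.Ico 1 n, τ * (n * τ - j * τ) ^ (q - 1) * (j * τ) ^ (p - 1)
      ≤ (2 ^ (1 - q) / p + 2 ^ (1 - p) / q) * (n * τ) ^ q * (n * τ) ^ (p - 1) := by
  have hn' : (0 : ℝ) < n := by exact_mod_cast hn
  set t : ℝ := n * τ with ht
  have ht0 : 0 < t := by positivity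
  have hhalf : ∀ r : ℝ, (t / 2) ^ (r - 1) = 2 ^ (1 - r) * (t ^ r / t) := by
    intro r
    rw [Real.div_rpow ht0.le (by norm_num), Real.rpow_sub_one ht0.ne', ← neg_sub r 1,
      Real.rpow_neg (by norm_num)]
    field_simp
  calc ∑ j ∈ Finset.Ico 1 n, τ * (t - j * τ) ^ (q - 1) * (j * τ) ^ (p - 1)
      ≤ ∑ j ∈ Finset.Ico 1 n, ((t / 2) ^ (q - 1) * (τ * (j * τ) ^ (p - 1))
          + (t / 2) ^ (p - 1) * (τ * (t - j * τ) ^ (q - 1))) := by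
        refine Finset.sum_le_sum fun j hj => ?_
        obtain ⟨hj1, hjn⟩ := Finset.mem_Ico.1 hj
        have hj1' : (0 : ℝ) < j := by exact_mod_cast hj1
        have hjn' : (j : ℝ) < n := by exact_mod_cast hjn
        have h := rpow_mul_rpow_le_of_add hp1 hq1 (a := t - j * τ) (b := j * τ)
          (by rw [ht]; nlinarith) (by positivity)
        rw [sub_add_cancel] at h
        nlinarith
    _ = (t / 2) ^ (q - 1) * ∑ j ∈ Finset.Ico 1 n, τ * (j * τ) ^ (p - 1)
          + (t / 2) ^ (p - 1) * ∑ j ∈ Finset.Ico 1 n, τ * (t - j * τ) ^ (q - 1) := by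
        rw [Finset.sum_add_distrib, Finset.mul_sum, Finset.mul_sum]
    _ ≤ (t / 2) ^ (q - 1) * (t ^ p / p) + (t / 2) ^ (p - 1) * (t ^ q / q) := by
        gcongr
        · exact sum_Ico_mul_rpow_le hp hp1 hτ n
        · exact sum_Ico_sub_mul_rpow_le hq hq1 hτ n
    _ = (2 ^ (1 - q) / p + 2 ^ (1 - p) / q) * t ^ q * t ^ (p - 1) := by
        rw [hhalf, hhalf, Real.rpow_sub_one ht0.ne']
        ring

theorem rpow_mul_exp_neg_le_one {q y : ℝ} (hq : 0 ≤ q) (hq1 : q ≤ 1) (hy : 0 ≤ y) :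
    y ^ q * Real.exp (-y) ≤ 1 := by
  rw [Real.exp_neg, ← div_eq_mul_inv, div_le_one (Real.exp_pos y)]
  have h2 : 1 + y ≤ Real.exp y := by linarith [Real.add_one_le_exp y]
  calc y ^ q ≤ (1 + y) ^ q := by gcongr; linarith
    _ ≤ (1 + y) ^ (1 : ℝ) := Real.rpow_le_rpow_of_exponent_le (by linarith) hq1
    _ ≤ Real.exp y := by rwa [Real.rpow_one]

/-- A discrete fractional Gronwall inequality with weakly singular inhomogeneity. -/
theorem exists_discrete_fractional_gronwall {α A B T : ℝ} (hα : 0 < α) (hα1 : α ≤ 1)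
    (hA : 0 ≤ A) (hB : 0 ≤ B) (hT : 0 < T) :
    ∃ C : ℝ, ∀ τ : ℝ, 0 < τ → ∀ N : ℕ, N * τ ≤ T → ∀ e : ℕ → ℝ,
      (∀ n : ℕ, 1 ≤ n → n ≤ N → e n ≤ A * (τ + (n * τ) ^ (α - 1) * τ ^ (1 + α))
        + B * ∑ j ∈ Finset.Ico 1 n, τ * (n * τ - j * τ) ^ (α - 1) * e j) →
      ∀ n : ℕ, 1 ≤ n → n ≤ N →
        e n ≤ C * (τ + (n * τ) ^ (α - 1) * τ ^ (1 + α)) := by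
  set q : ℝ := α / 2 with hq
  have hq0 : 0 < q := by positivity
  have hq1 : q ≤ 1 := by linarith
  set K : ℝ := (1 / q + (2 ^ (1 - q) / α + 2 ^ (1 - α) / q)) * T ^ q with hK
  have hK0 : 0 < K := by positivity
  set γ : ℝ := (2 * B * K + 1) ^ q⁻¹ with hγ
  have hγ0 : 0 < γ := by positivity
  have hγq : γ ^ q = 2 * B * K + 1 := by
    rw [hγ, ← Real.rpow_mul (by positivity), inv_mul_cancel₀ hq0.ne', Real.rpow_one]
  refine ⟨2 * A * Real.exp (γ * T), fun τ hτ N hN e he => ?_⟩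
  set g : ℕ → ℝ := fun n => τ + (n * τ) ^ (α - 1) * τ ^ (1 + α) with hg
  have hg0 : ∀ n, 0 ≤ g n := fun n => by positivity
  have hnT : ∀ n : ℕ, n ≤ N → n * τ ≤ T := fun n hn =>
    (mul_le_mul_of_nonneg_right (by exact_mod_cast hn) hτ.le).trans hN
  have hbeta : ∀ n : ℕ, 1 ≤ n → n ≤ N →
      ∑ j ∈ Finset.Ico 1 n, τ * (n * τ - j * τ) ^ (q - 1) * g j ≤ K * g n := by
    intro n hn1 hnN
    have h1 := sum_Ico_sub_mul_rpow_le hq0 hq1 hτ n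
    have h2 := sum_Ico_beta_le hα hα1 hq0 hq1 hτ hn1
    have hTq : (n * τ) ^ q ≤ T ^ q := by
      have := hnT n hnN
      gcongr
    have hsplit : ∑ j ∈ Finset.Ico 1 n, τ * (n * τ - j * τ) ^ (q - 1) * g j
        = τ * ∑ j ∈ Finset.Ico 1 n, τ * (n * τ - j * τ) ^ (q - 1)
          + τ ^ (1 + α) * ∑ j ∈ Finset.Ico 1 n,
              τ * (n * τ - j * τ) ^ (q - 1) * (j * τ) ^ (α - 1) := by
      rw [Finset.mul_sum, Finset.mul_sum, ← Finset.sum_add_distrib]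
      exact Finset.sum_congr rfl fun j _ => by simp only [hg]; ring
    set c : ℝ := 2 ^ (1 - q) / α + 2 ^ (1 - α) / q with hc
    have hc0 : 0 < c := by positivity
    calc _ ≤ τ * ((n * τ) ^ q / q)
          + τ ^ (1 + α) * (c * (n * τ) ^ q * (n * τ) ^ (α - 1)) := by
          rw [hsplit]; gcongr
      _ ≤ τ * (T ^ q / q) + τ ^ (1 + α) * (c * T ^ q * (n * τ) ^ (α - 1)) := by gcongr
      _ = (1 / q * T ^ q) * τ + (c * T ^ q) * ((n * τ) ^ (α - 1) * τ ^ (1 + α)) := by ring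
      _ ≤ K * τ + K * ((n * τ) ^ (α - 1) * τ ^ (1 + α)) := by
          gcongr
          · rw [hK]; gcongr; linarith
          · rw [hK]; gcongr
            have : 0 < 1 / q := by positivity
            linarith
      _ = K * g n := by simp only [hg]; ring
  have hmain : ∀ n : ℕ, 1 ≤ n → n ≤ N → e n ≤ 2 * A * Real.exp (γ * (n * τ)) * g n := by
    intro n
    induction n using Nat.strong_induction_on with
    | _ n ih =>
      intro hn1 hnN
      have hterm : ∀ j ∈ Finset.Ico 1 n, τ * (n * τ - j * τ) ^ (α - 1) * e j
          ≤ 2 * A * Real.exp (γ * (n * τ)) / γ ^ q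
            * (τ * (n * τ - j * τ) ^ (q - 1) * g j) := by
        intro j hj
        obtain ⟨hj1, hjn⟩ := Finset.mem_Ico.1 hj
        have hjn' : (j : ℝ) < n := by exact_mod_cast hjn
        have hs : 0 < n * τ - j * τ := by nlinarith
        set s : ℝ := n * τ - j * τ with hs_def
        have hexp := rpow_mul_exp_neg_le_one hq0.le hq1 (mul_pos hγ0 hs).le
        rw [Real.mul_rpow hγ0.le hs.le] at hexp
        have hsplit : s ^ (α - 1) = s ^ (q - 1) * s ^ q := by
          rw [← Real.rpow_add hs]
          congr 1
          rw [hq]; ring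
        have hexp2 : Real.exp (γ * (j * τ))
            = Real.exp (γ * (n * τ)) * Real.exp (-(γ * s)) := by
          rw [← Real.exp_add]
          congr 1
          rw [hs_def]; ring
        calc τ * s ^ (α - 1) * e j
            ≤ τ * s ^ (α - 1) * (2 * A * Real.exp (γ * (j * τ)) * g j) := by
              gcongr
              exact ih j hjn hj1 (hjn.le.trans hnN)
          _ = 2 * A * Real.exp (γ * (n * τ)) / γ ^ q * (τ * s ^ (q - 1) * g j)
                * (γ ^ q * s ^ q * Real.exp (-(γ * s))) := by
              rw [hsplit, hexp2]
              field_simp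
          _ ≤ _ := by
              refine mul_le_of_le_one_right ?_ hexp
              have := hg0 j
              positivity
      have hE : 1 ≤ Real.exp (γ * (n * τ)) := Real.one_le_exp (by positivity)
      set E : ℝ := Real.exp (γ * (n * τ)) with hE_def
      have hgn := hg0 n
      calc e n ≤ A * g n
            + B * ∑ j ∈ Finset.Ico 1 n, τ * (n * τ - j * τ) ^ (α - 1) * e j := he n hn1 hnN
        _ ≤ A * g n + B * (2 * A * E / γ ^ q * (K * g n)) := by
            gcongr
            refine (Finset.sum_le_sum hterm).trans ?_
            rw [← Finset.mul_sum]
            gcongr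
            exact hbeta n hn1 hnN
        _ = A * g n + A * E * g n * (2 * B * K / γ ^ q) := by ring
        _ ≤ A * E * g n + A * E * g n * 1 := by
            gcongr
            · exact le_mul_of_one_le_right hA hE
            · rw [hγq, div_le_one (by positivity)]
              linarith
        _ = 2 * A * E * g n := by ring
  intro n hn1 hnN
  refine (hmain n hn1 hnN).trans ?_
  have := hnT n hnN
  have hgn := hg0 n
  gcongr

theorem intervalIntegrable_mlKernel_sub {α : ℝ} (hα : 0 < α) (lam t a b : ℝ) :
    IntervalIntegrable (fun r => mlKernel α lam (t - r)) volume a b := by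
  simpa using (intervalIntegrable_mlKernel hα lam (t - a) (t - b)).comp_sub_left t

theorem eiWeight_eq_integral {α : ℝ} (hα : 0 < α) (lam : ℝ) {τ : ℝ} (hτ : 0 < τ) {n j : ℕ}
    (hj : j < n) :
    eiWeight α lam τ n j
      = ∫ r in (j * τ)..((j + 1 : ℕ) * τ), mlKernel α lam (n * τ - r) := by
  have hj' : (j : ℝ) + 1 ≤ n := by exact_mod_cast hj
  rw [intervalIntegral.integral_comp_sub_left (mlKernel α lam),
    ← intervalIntegral.integral_interval_sub_left (intervalIntegrable_mlKernel hα lam 0 _)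
      (intervalIntegrable_mlKernel hα lam 0 _), integral_mlKernel hα lam (by nlinarith),
    integral_mlKernel hα lam (by push_cast; nlinarith), eiWeight]
  push_cast
  rfl

theorem abs_integral_mlKernel_mul_le {α lam T a b t c D : ℝ} {f : ℝ → ℝ} (hα : 0 < α)
    (hα1 : α ≤ 1) (hlam : 0 ≤ lam) (ha : 0 ≤ a) (hab : a ≤ b) (hat : a < t) (hbt : b ≤ t)
    (htT : t ≤ T) (hf : ContinuousOn f (Icc a b)) (hD : ∀ r ∈ Icc a b, |f r - c| ≤ D) :
    |(∫ r in a..b, mlKernel α lam (t - r) * f r) - (∫ r in a..b, mlKernel α lam (t - r)) * c|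
      ≤ mlE α α (lam * T ^ α) / α * D * ((b - a) * (t - a) ^ (α - 1)) := by
  set M : ℝ := mlE α α (lam * T ^ α) with hM
  have hT : 0 ≤ T := by linarith
  have hM0 : 0 ≤ M := mlE_nonneg hα hα (by positivity)
  have hD0 : 0 ≤ D := (abs_nonneg _).trans (hD a (left_mem_Icc.2 hab))
  have hk := intervalIntegrable_mlKernel_sub hα lam t a b
  have hkf : IntervalIntegrable (fun r => mlKernel α lam (t - r) * f r) volume a b :=
    hk.mul_continuousOn (by rwa [uIcc_of_le hab])
  have hpow : IntervalIntegrable (fun r => M * D * (t - r) ^ (α - 1)) volume a b := by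
    refine IntervalIntegrable.const_mul ?_ _
    simpa using (intervalIntegral.intervalIntegrable_rpow' (r := α - 1) (a := t - a)
      (b := t - b) (by linarith)).comp_sub_left t
  rw [← intervalIntegral.integral_mul_const,
    ← intervalIntegral.integral_sub hkf (hk.mul_const c), ← Real.norm_eq_abs]
  refine (intervalIntegral.norm_integral_le_of_norm_le hab
    (Filter.Eventually.of_forall fun r hr => ?_) hpow).trans ?_
  · rw [← mul_sub, norm_mul, Real.norm_eq_abs, Real.norm_eq_abs]
    have h1 := abs_mlKernel_le hα hlam (s := t - r) (T := T) (by linarith [hr.2])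
      (by linarith [hr.1])
    have h2 := hD r (Ioc_subset_Icc_self hr)
    have h3 : 0 ≤ (t - r) ^ (α - 1) := Real.rpow_nonneg (by linarith [hr.2]) _
    calc |mlKernel α lam (t - r)| * |f r - c| ≤ (M * (t - r) ^ (α - 1)) * D := by gcongr
      _ = M * D * (t - r) ^ (α - 1) := by ring
  · rw [intervalIntegral.integral_const_mul,
      intervalIntegral.integral_comp_sub_left (fun s : ℝ => s ^ (α - 1)),
      integral_rpow (Or.inl (by linarith)), sub_add_cancel]
    have h := rpow_sub_rpow_le hα.le hα1 (a := t - a) (b := t - b) (by linarith) (by linarith)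
      (by linarith)
    rw [show t - a - (t - b) = b - a by ring] at h
    calc M * D * (((t - a) ^ α - (t - b) ^ α) / α)
        ≤ M * D * (((b - a) * (t - a) ^ (α - 1)) / α) := by gcongr
      _ = _ := by ring

/-- Convergence of the exponential integrator scheme for the scalar semilinear
fractional equation `D^α u + λ u = F(u)` in mild (variation-of-constants) form:
there is `C`, depending only on `α, λ, L_F, L₀, T`, such that the exponential
integrator approximations `Uⁿ` satisfy
`|u(t_n) − Uⁿ| ≤ C (τ + t_n^{α−1} τ^{1+α})` for `1 ≤ n ≤ N`. -/
theorem ei_convergence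
    (α lam LF L0 T : ℝ) (hα : 0 < α) (hα1 : α < 1) (hlam : 0 ≤ lam)
    (hLF : 0 ≤ LF) (hL0 : 0 ≤ L0) (hT : 0 < T) :
    ∃ C : ℝ,
      ∀ F : ℝ → ℝ, (∀ x y : ℝ, |F x - F y| ≤ LF * |x - y|) →
      ∀ τ : ℝ, 0 < τ → ∀ N : ℕ, (N : ℝ) * τ = T →
      ∀ u : ℝ → ℝ, ContinuousOn u (Icc 0 T) →
      (∀ t ∈ Icc (0:ℝ) T,
          u t = mlE α 1 (-lam * t ^ α) * u 0
            + ∫ r in (0:ℝ)..t,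
                (t - r) ^ (α - 1) * mlE α α (-lam * (t - r) ^ α) * F (u r)) →
      (∀ r ∈ Icc (0:ℝ) τ, ∀ r' ∈ Icc (0:ℝ) τ, |u r - u r'| ≤ L0 * |r - r'| ^ α) →
      (∀ r ∈ Icc τ T, ∀ r' ∈ Icc τ T, |u r - u r'| ≤ L0 * |r - r'|) →
      ∀ U : ℕ → ℝ, U 0 = u 0 →
      (∀ n : ℕ, 1 ≤ n → n ≤ N →
          U n = mlE α 1 (-lam * ((n : ℝ) * τ) ^ α) * U 0
            + ∑ j ∈ Finset.range n, eiWeight α lam τ n j * F (U j)) →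
      ∀ n : ℕ, 1 ≤ n → n ≤ N →
        |u ((n : ℝ) * τ) - U n|
          ≤ C * (τ + ((n : ℝ) * τ) ^ (α - 1) * τ ^ (1 + α)) := by
  set M : ℝ := mlE α α (lam * T ^ α) with hM
  have hM0 : 0 ≤ M := mlE_nonneg hα hα (by positivity)
  set B : ℝ := M / α * LF with hB
  have hB0 : 0 ≤ B := by positivity
  obtain ⟨C, hC⟩ := exists_discrete_fractional_gronwall (A := B * L0 * (1 + T ^ α / α)) hα
    hα1.le (by positivity) hB0 hT
  refine ⟨C, fun F hF τ hτ N hN u hu hmild hreg0 hreg U hU0 hU => ?_⟩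
  refine hC τ hτ N hN.le (fun n => |u (n * τ) - U n|) fun n hn1 hnN => ?_
  have hn0 : (0 : ℝ) < n := by exact_mod_cast hn1
  have hnT : n * τ ≤ T := by
    rw [← hN]
    exact mul_le_mul_of_nonneg_right (by exact_mod_cast hnN) hτ.le
  have hFc : Continuous F :=
    (LipschitzWith.of_dist_le' (K := LF) fun x y => by
      simpa only [Real.dist_eq] using hF x y).continuous
  have hFu : ContinuousOn (fun r => F (u r)) (Icc 0 T) := hFc.comp_continuousOn hu
  have hjT : ∀ j < n, ((j + 1 : ℕ) : ℝ) * τ ≤ n * τ := fun j hj =>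
    mul_le_mul_of_nonneg_right (by exact_mod_cast hj) hτ.le
  have hstep : ∀ j : ℕ, (j : ℝ) * τ ≤ (j + 1 : ℕ) * τ := fun j =>
    mul_le_mul_of_nonneg_right (by exact_mod_cast j.le_succ) hτ.le
  have hsub : ∀ j < n, Icc ((j : ℝ) * τ) ((j + 1 : ℕ) * τ) ⊆ Icc 0 T := fun j hj =>
    Icc_subset_Icc (by positivity) ((hjT j hj).trans hnT)
  have herr : u (n * τ) - U n = ∑ j ∈ Finset.range n,
      ((∫ r in (j * τ)..((j + 1 : ℕ) * τ), mlKernel α lam (n * τ - r) * F (u r))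
        - (∫ r in (j * τ)..((j + 1 : ℕ) * τ), mlKernel α lam (n * τ - r)) * F (U j)) := by
    have hadj := intervalIntegral.sum_integral_adjacent_intervals (μ := volume)
      (f := fun r => mlKernel α lam (n * τ - r) * F (u r)) (a := fun j : ℕ => j * τ) (n := n)
      fun j hj => (intervalIntegrable_mlKernel_sub hα lam _ _ _).mul_continuousOn (by
        rw [uIcc_of_le (hstep j)]
        exact hFu.mono (hsub j hj))
    rw [hmild _ ⟨by positivity, hnT⟩, hU n hn1 hnN, hU0, add_sub_add_left_eq_sub,
      Finset.sum_sub_distrib, hadj]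
    simp only [Nat.cast_zero, zero_mul]
    congr 1
    exact Finset.sum_congr rfl fun j hj => by
      rw [eiWeight_eq_integral hα lam hτ (Finset.mem_range.1 hj)]
  have hpiece : ∀ j < n, ∀ δ : ℝ,
      (∀ r ∈ Icc (j * τ) ((j + 1 : ℕ) * τ), |u r - u (j * τ)| ≤ δ) →
      |(∫ r in (j * τ)..((j + 1 : ℕ) * τ), mlKernel α lam (n * τ - r) * F (u r))
        - (∫ r in (j * τ)..((j + 1 : ℕ) * τ), mlKernel α lam (n * τ - r)) * F (U j)|
      ≤ B * (τ * (n * τ - j * τ) ^ (α - 1)) * (δ + |u (j * τ) - U j|) := by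
    intro j hj δ hδ
    have hj' : (j : ℝ) < n := by exact_mod_cast hj
    refine (abs_integral_mlKernel_mul_le (D := LF * (δ + |u (j * τ) - U j|)) hα hα1.le hlam
      (by positivity) (hstep j) (by nlinarith) (hjT j hj) hnT (hFu.mono (hsub j hj))
      fun r hr => (hF _ _).trans ?_).trans (le_of_eq ?_)
    · gcongr
      exact (abs_sub_le _ _ _).trans (add_le_add_left (hδ r hr) _)
    · rw [hB, ← hM]
      push_cast
      ring
  have hfirst := hpiece 0 hn1 (L0 * τ ^ α) fun r hr => by
    simp only [Nat.cast_zero, zero_mul, zero_add, Nat.cast_one, one_mul] at hr ⊢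
    refine (hreg0 r hr 0 ⟨le_rfl, hτ.le⟩).trans ?_
    rw [sub_zero, abs_of_nonneg hr.1]
    have := hr.1
    have := hr.2
    gcongr
  have hrest : ∀ j ∈ Finset.Ico 1 n,
      |(∫ r in (j * τ)..((j + 1 : ℕ) * τ), mlKernel α lam (n * τ - r) * F (u r))
        - (∫ r in (j * τ)..((j + 1 : ℕ) * τ), mlKernel α lam (n * τ - r)) * F (U j)|
      ≤ B * L0 * τ * (τ * (n * τ - j * τ) ^ (α - 1))
        + B * (τ * (n * τ - j * τ) ^ (α - 1) * |u (j * τ) - U j|) := by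
    intro j hj
    obtain ⟨hj1, hjn⟩ := Finset.mem_Ico.1 hj
    have hτj : τ ≤ j * τ := le_mul_of_one_le_left hτ.le (by exact_mod_cast hj1)
    refine (hpiece j hjn (L0 * τ) fun r hr => ?_).trans (le_of_eq (by ring))
    have hrT := (hsub j hjn hr).2
    refine (hreg r ⟨hτj.trans hr.1, hrT⟩ (j * τ) ⟨hτj, hr.1.trans hrT⟩).trans ?_
    rw [abs_of_nonneg (sub_nonneg.2 hr.1)]
    have := hr.2
    push_cast at this
    gcongr
    linarith
  have hsum := sum_Ico_sub_mul_rpow_le hα hα1.le hτ n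
  have hsum' : ∑ j ∈ Finset.Ico 1 n, τ * (n * τ - j * τ) ^ (α - 1) ≤ T ^ α / α :=
    hsum.trans (by gcongr)
  have hw : 0 ≤ (n * τ) ^ (α - 1) * τ ^ (1 + α) := by positivity
  have hτα : τ ^ (1 + α) = τ * τ ^ α := by rw [Real.rpow_add hτ, Real.rpow_one]
  simp only [Nat.cast_zero, zero_mul, hU0, sub_self, abs_zero, add_zero, sub_zero] at hfirst
  simp only [herr]
  refine (Finset.abs_sum_le_sum_abs _ _).trans ?_
  rw [Finset.range_eq_Ico, Finset.sum_eq_sum_Ico_succ_bot hn1]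
  simp only [Nat.cast_zero, zero_mul, hU0, zero_add] at hfirst ⊢
  have hα0 : 0 ≤ B * L0 * (T ^ α / α) := by positivity
  have hBL : 0 ≤ B * L0 := by positivity
  calc _ ≤ B * (τ * (n * τ) ^ (α - 1)) * (L0 * τ ^ α)
        + ∑ j ∈ Finset.Ico 1 n, (B * L0 * τ * (τ * (n * τ - j * τ) ^ (α - 1))
          + B * (τ * (n * τ - j * τ) ^ (α - 1) * |u (j * τ) - U j|)) :=
        add_le_add hfirst (Finset.sum_le_sum hrest)
    _ = B * L0 * ((n * τ) ^ (α - 1) * τ ^ (1 + α))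
        + B * L0 * τ * ∑ j ∈ Finset.Ico 1 n, τ * (n * τ - j * τ) ^ (α - 1)
        + B * ∑ j ∈ Finset.Ico 1 n, τ * (n * τ - j * τ) ^ (α - 1) * |u (j * τ) - U j| := by
        rw [Finset.sum_add_distrib, Finset.mul_sum, Finset.mul_sum, hτα]
        ring
    _ ≤ B * L0 * ((n * τ) ^ (α - 1) * τ ^ (1 + α)) + B * L0 * τ * (T ^ α / α)
        + B * ∑ j ∈ Finset.Ico 1 n, τ * (n * τ - j * τ) ^ (α - 1) * |u (j * τ) - U j| := by
        gcongr
    _ ≤ _ := by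
        have h1 := mul_nonneg hα0 hw
        have h2 := mul_nonneg hBL hτ.le
        linarith
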